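/- Let T and K be natural numbers with 1 ≤ K ≤ T, and let v ∈ ℝ^T have nonnegative entries with ∑_{s=0}^{T-1} v_s² = T. If v maximizes the K-spectral metric R(v,K) over this constraint set, then v_i = 0 for every index i outside some set of indices of the K largest entries of v; that is, at most K entries of v are nonzero. -/

import Mathlib

/-- The K-spectral metric: the sum of the `K` largest entries of `v`,
i.e. the supremum over `K`-element index sets `S` of `∑ i ∈ S, v i`. -/
noncomputable def Kspec {T : ℕ} (K : ℕ) (v : Fin T → ℝ) : ℝ :=
  sSup {x : ℝ | ∃ S : Finset (Fin T), S.card = K ∧ x = ∑ i ∈ S, v i}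

theorem finite_setOf_card_eq_sum {T : ℕ} (K : ℕ) (v : Fin T → ℝ) :
    {x : ℝ | ∃ S : Finset (Fin T), S.card = K ∧ x = ∑ i ∈ S, v i}.Finite :=
  (Set.finite_range fun S : Finset (Fin T) => ∑ i ∈ S, v i).subset <| by
    rintro x ⟨S, -, rfl⟩
    exact ⟨S, rfl⟩

theorem sum_le_Kspec {T : ℕ} {K : ℕ} (v : Fin T → ℝ) {S : Finset (Fin T)} (hS : S.card = K) :
    ∑ i ∈ S, v i ≤ Kspec K v :=
  le_csSup (finite_setOf_card_eq_sum K v).bddAbove ⟨S, hS, rfl⟩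

theorem exists_card_eq_Kspec_eq_sum {T K : ℕ} (hKT : K ≤ T) (v : Fin T → ℝ) :
    ∃ S : Finset (Fin T), S.card = K ∧ Kspec K v = ∑ i ∈ S, v i := by
  obtain ⟨S, -, hS⟩ := Finset.exists_subset_card_eq
    (show K ≤ (Finset.univ : Finset (Fin T)).card by simpa using hKT)
  have hne : {x : ℝ | ∃ S : Finset (Fin T), S.card = K ∧ x = ∑ i ∈ S, v i}.Nonempty :=
    ⟨_, S, hS, rfl⟩
  exact hne.csSup_mem (finite_setOf_card_eq_sum K v)

/-- If a nonnegative `v ∈ ℝ^T` with `∑ s, v s ^ 2 = T` maximizes the K-spectral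
metric over this constraint set, then at most `K` entries of `v` are nonzero. -/
theorem kspec_max_support_le (T K : ℕ) (hK : 1 ≤ K) (hKT : K ≤ T)
    (v : Fin T → ℝ) (hv : ∀ i, 0 ≤ v i) (hsum : ∑ s, v s ^ 2 = (T : ℝ))
    (hmax : ∀ w : Fin T → ℝ, (∀ i, 0 ≤ w i) → ∑ s, w s ^ 2 = (T : ℝ) →
      Kspec K w ≤ Kspec K v) :
    (Finset.univ.filter fun i => v i ≠ 0).card ≤ K := by
  obtain ⟨S, hS, hSv⟩ := exists_card_eq_Kspec_eq_sum hKT v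
  have hK0 : (0 : ℝ) < K := by exact_mod_cast hK
  obtain ⟨c, hc0, hc⟩ : ∃ c : ℝ, 0 ≤ c ∧ K * c ^ 2 = T :=
    ⟨√(T / K), Real.sqrt_nonneg _, by rw [Real.sq_sqrt (by positivity)]; field_simp⟩
  -- The vector equal to `c` on `S` and zero elsewhere is a competitor.
  have hle : K * c ≤ ∑ i ∈ S, v i := by
    have hw := hmax (fun i => if i ∈ S then c else 0)
      (fun i => by split_ifs <;> simp [hc0])
      (by simp [ite_pow, hS, hc])
    have hsumw := sum_le_Kspec (fun i => if i ∈ S then c else 0) hS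
    simp only [Finset.sum_ite_mem, Finset.inter_self, Finset.sum_const, hS, nsmul_eq_mul] at hsumw
    linarith
  have hcs : (∑ i ∈ S, v i) ^ 2 ≤ K * ∑ i ∈ S, v i ^ 2 := by
    simpa [hS] using sq_sum_le_card_mul_sum_sq (s := S) (f := v)
  have hT : (T : ℝ) ≤ ∑ i ∈ S, v i ^ 2 := by
    have hsq : (K * c) ^ 2 ≤ (∑ i ∈ S, v i) ^ 2 := by gcongr
    refine le_of_mul_le_mul_left ?_ hK0
    calc (K : ℝ) * T = (K * c) ^ 2 := by rw [← hc]; ring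
      _ ≤ _ := hsq.trans hcs
  have hcompl : ∑ i ∈ Sᶜ, v i ^ 2 = 0 := by
    have hnonneg : 0 ≤ ∑ i ∈ Sᶜ, v i ^ 2 := Finset.sum_nonneg fun i _ => sq_nonneg _
    linarith [Finset.sum_add_sum_compl S fun i => v i ^ 2]
  rw [Finset.sum_eq_zero_iff_of_nonneg fun i _ => sq_nonneg _] at hcompl
  rw [← hS]
  refine Finset.card_le_card fun i hi => ?_
  by_contra hiS
  exact (Finset.mem_filter.mp hi).2
    (pow_eq_zero_iff two_ne_zero |>.mp (hcompl i (Finset.mem_compl.mpr hiS)))
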